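/- arXiv:1305.0384 — 2 statements merged into one kernel-verified Lean document; each statement's English description precedes it below -/
import Mathlib

section
/- (Theorem 1, binary version: convergence of Iterative Binary Power Packing for two links.) Let N = 2 and M ≥ 1. Let s : ℕ → {1,2} be an update sequence in which each of 1 and 2 occurs infinitely often. Starting from an arbitrary binary allocation p[0] ∈ {0,P_max}^{2M}, define p[t] from p[t−1] by replacing link-s[t]'s allocation with its BPP response (with ties in interference broken by slot index) to the interference generated by the other link's allocation in p[t−1], the other link's allocation being unchanged. If the target rate vector R^t = (R^t_1, R^t_2) satisfies R^t ∈ R_M^IBPP (i.e., there exists a repulsive binary allocation q with R^t_i ≤ R_i(q), i = 1,2), then there exists a finite time T such that p[t] = p[T] for all t ≥ T, and p[T] is a repulsive binary allocation satisfying R_i(p[T]) ≥ R^t_i for i = 1, 2. -/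
open Finset

/-- Frame rate on link `i` for an `M`-slot power allocation. -/
noncomputable def frameRate {N M : ℕ} (f : ℝ → ℝ) (g : Fin N → Fin N → ℝ) (N0 : ℝ)
    (p : Fin N → Fin M → ℝ) (i : Fin N) : ℝ :=
  (1 / (M : ℝ)) * ∑ m, f (g i i * p i m / (N0 + ∑ j ∈ univ \ {i}, g j i * p j m))

/-- A two-link `M`-slot allocation `p` is repulsive if, after a permutation `σ`
of the slots (slots indexed `1,…,M` via `m.val + 1`), link 1 transmits at full
power in a prefix (up to slot `m₁`, with slot `m₁+1` arbitrary and zero after)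
and link 2 transmits at full power in a suffix (from slot `m₂`, with slot
`m₂−1` arbitrary and zero before). -/
def Repulsive {M : ℕ} (Pmax : ℝ) (p : Fin 2 → Fin M → ℝ) : Prop :=
  ∃ σ : Equiv.Perm (Fin M), ∃ m₁ m₂ : ℕ, m₁ ≤ M + 1 ∧ m₂ ≤ M + 1 ∧
    ∀ m : Fin M,
      (m.val + 1 ≤ m₁ → p 0 (σ m) = Pmax) ∧
      (m₁ + 1 < m.val + 1 → p 0 (σ m) = 0) ∧
      (m₂ ≤ m.val + 1 → p 1 (σ m) = Pmax) ∧
      (m.val + 1 < m₂ - 1 → p 1 (σ m) = 0)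

/-- `q` is the Binary Power Packing response (ties in interference broken by
slot index) to interference levels `I`, for a transmitter with direct gain
`gii`, power budget `Pmax` and target rate `Rt`: if even full power in every
slot does not reach the target, `q = 0`; otherwise, sort the slots by
nondecreasing interference (ties broken by slot index) via the permutation `σ`,
and transmit at full power exactly in the first `m̃` slots, where `m̃` is the
least number of slots whose full-power rates reach the target. -/
def IsBPPResponse {M : ℕ} (f : ℝ → ℝ) (gii Pmax Rt : ℝ)
    (I : Fin M → ℝ) (q : Fin M → ℝ) : Prop :=
  ((1 / (M : ℝ)) * ∑ m, f (gii * Pmax / I m) < Rt → q = 0) ∧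
  (Rt ≤ (1 / (M : ℝ)) * ∑ m, f (gii * Pmax / I m) →
    ∃ σ : Equiv.Perm (Fin M),
      (∀ l l' : Fin M, l < l' →
        I (σ l) < I (σ l') ∨ (I (σ l) = I (σ l') ∧ σ l < σ l')) ∧
      ∃ mt : ℕ,
        IsLeast {k : ℕ | Rt ≤ (1 / (M : ℝ)) *
          ∑ m ∈ univ.filter (fun m : Fin M => m.val < k),
            f (gii * Pmax / I (σ m))} mt ∧
        ∀ m : Fin M, q (σ m) = if m.val < mt then Pmax else 0)

/-! ### Sequences of natural numbers -/

theorem eventually_const_of_antitone_from (u : ℕ → ℕ) (T : ℕ)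
    (h : ∀ t, T ≤ t → u (t + 1) ≤ u t) : ∃ T', T ≤ T' ∧ ∀ t, T' ≤ t → u t = u T' := by
  have hle : ∀ t t', T ≤ t → t ≤ t' → u t' ≤ u t := by
    intro t t' ht htt'
    induction t', htt' using Nat.le_induction with
    | base => exact le_rfl
    | succ t' htt' ih => exact (h t' (by omega)).trans ih
  obtain ⟨T', hT', hmin⟩ := WellFounded.has_min (measure u).wf {t | T ≤ t} ⟨T, le_refl T⟩
  exact ⟨T', hT', fun t ht =>
    le_antisymm (hle T' t hT' ht) (not_lt.1 (hmin t (le_trans hT' ht)))⟩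

/-! ### The dynamics of the numbers of active slots

`F i k b` says that link `i` meets its target with `k` well-chosen active slots when the other
link `1 - i` has `b` active slots; `u t` is the link updated between times `t` and `t + 1`. -/

section Counts

variable {F : Fin 2 → ℕ → ℕ → Prop} {M : ℕ} {u : ℕ → Fin 2} {n : ℕ → Fin 2 → ℕ}

theorem counts_eventually_const_of_feasible
    (hmono : ∀ i k k' b, k ≤ k' → F i k b → F i k' b)
    (hanti : ∀ i k b b', b' ≤ b → F i k b → F i k b')
    (hM : ∀ t i, n t i ≤ M)
    (hother : ∀ t, n (t + 1) (1 - u t) = n t (1 - u t))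
    (T : ℕ) (hleast : ∀ t, T ≤ t → IsLeast {k | F (u t) k (n t (1 - u t))} (n (t + 1) (u t))) :
    ∃ T', T ≤ T' ∧ ∀ t, T' ≤ t → ∀ i, n t i = n T' i := by
  have key : ∀ i j : Fin 2, j = i ∨ j = 1 - i := by decide
  have inv : ∀ i : Fin 2, 1 - (1 - i) = i := by decide
  have first : (∀ i, F i (n (T + 1) i) (n (T + 1) (1 - i))) ∨
      (∀ i k, F i k (n (T + 1) (1 - i)) → n (T + 1) i ≤ k) := by
    have hl := hleast T le_rfl
    have ho := hother T
    rw [← ho] at hl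
    by_cases hF : F (1 - u T) (n (T + 1) (1 - u T)) (n (T + 1) (u T))
    · left
      intro i
      rcases key (u T) i with rfl | rfl
      · exact hl.1
      · rwa [inv]
    · right
      intro i k hk
      rcases key (u T) i with rfl | rfl
      · exact hl.2 hk
      · rw [inv] at hk
        by_contra hlt
        exact hF (hmono _ _ _ _ (by omega) hk)
  have conv : ∀ v : ℕ → Fin 2 → ℕ, (∀ i t, T + 1 ≤ t → v (t + 1) i ≤ v t i) →
      ∃ T', T ≤ T' ∧ ∀ t, T' ≤ t → ∀ i, v t i = v T' i := by
    intro v hv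
    obtain ⟨T₀, h₀, hc₀⟩ := eventually_const_of_antitone_from (fun t => v t 0) (T + 1) (hv 0)
    obtain ⟨T₁, h₁, hc₁⟩ := eventually_const_of_antitone_from (fun t => v t 1) (T + 1) (hv 1)
    refine ⟨max T₀ T₁, by omega, fun t ht i => ?_⟩
    match i with
    | 0 => exact (hc₀ t (by omega)).trans (hc₀ _ (by omega)).symm
    | 1 => exact (hc₁ t (by omega)).trans (hc₁ _ (by omega)).symm
  rcases first with hD | hL
  · have step : ∀ t, T + 1 ≤ t → (∀ i, F i (n t i) (n t (1 - i))) → ∀ i, n (t + 1) i ≤ n t i := by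
      intro t ht h i
      rcases key (u t) i with rfl | rfl
      · exact (hleast t (by omega)).2 (h _)
      · exact (hother t).le
    have all : ∀ t, T + 1 ≤ t → ∀ i, F i (n t i) (n t (1 - i)) := by
      intro t ht
      induction t, ht using Nat.le_induction with
      | base => exact hD
      | succ t ht ih =>
        have hle := step t ht ih
        intro i
        rcases key (u t) i with rfl | rfl
        · rw [hother]; exact (hleast t (by omega)).1
        · rw [hother]; exact hanti _ _ _ _ (hle _) (ih _)
    exact conv n fun i t ht => step t ht (all t ht) i
  · have step : ∀ t, T + 1 ≤ t → (∀ i k, F i k (n t (1 - i)) → n t i ≤ k) →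
        ∀ i, n t i ≤ n (t + 1) i := by
      intro t ht h i
      rcases key (u t) i with rfl | rfl
      · exact h _ _ (hleast t (by omega)).1
      · exact (hother t).ge
    have all : ∀ t, T + 1 ≤ t → ∀ i k, F i k (n t (1 - i)) → n t i ≤ k := by
      intro t ht
      induction t, ht using Nat.le_induction with
      | base => exact hL
      | succ t ht ih =>
        have hle := step t ht ih
        intro i k hk
        rcases key (u t) i with rfl | rfl
        · rw [hother] at hk; exact (hleast t (by omega)).2 hk
        · rw [hother]; exact ih _ _ (hanti _ _ _ _ (hle _) hk)
    obtain ⟨T', h, hc⟩ := conv (fun t i => M - n t i) fun i t ht =>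
      Nat.sub_le_sub_left (step t ht (all t ht) i) M
    refine ⟨T', h, fun t ht i => ?_⟩
    have h₁ := hc t ht i
    have h₂ := hM t i
    have h₃ := hM T' i
    omega

theorem counts_eventually_const
    (hmono : ∀ i k k' b, k ≤ k' → F i k b → F i k' b)
    (hanti : ∀ i k b b', b' ≤ b → F i k b → F i k b')
    (hu : ∀ i t, ∃ t', t ≤ t' ∧ u t' = i)
    (hM : ∀ t i, n t i ≤ M)
    (hother : ∀ t, n (t + 1) (1 - u t) = n t (1 - u t))
    (hleast : ∀ t, F (u t) M (n t (1 - u t)) →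
      IsLeast {k | F (u t) k (n t (1 - u t))} (n (t + 1) (u t)))
    (hzero : ∀ t, ¬ F (u t) M (n t (1 - u t)) → n (t + 1) (u t) = 0)
    (q : Fin 2 → ℕ) (hqM : ∀ i, q i ≤ M) (hq : ∀ i, F i (q i) (q (1 - i))) :
    ∃ T, ∀ t, T ≤ t → F (u t) M (n t (1 - u t)) ∧ ∀ i, n t i = n T i := by
  have key : ∀ i j : Fin 2, j = i ∨ j = 1 - i := by decide
  have inv : ∀ i : Fin 2, 1 - (1 - i) = i := by decide
  suffices hfeas : ∃ T, ∀ t, T ≤ t → F (u t) M (n t (1 - u t)) by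
    obtain ⟨T, hT⟩ := hfeas
    obtain ⟨T', h, hc⟩ := counts_eventually_const_of_feasible hmono hanti hM hother T
      fun t ht => hleast t (hT t ht)
    exact ⟨T', fun t ht => ⟨hT t (by omega), hc t ht⟩⟩
  have feas : ∀ t, n t (1 - u t) ≤ q (1 - u t) → F (u t) M (n t (1 - u t)) := fun t h =>
    hmono _ _ _ _ (hqM _) (hanti _ _ _ _ h (hq _))
  have le_q : ∀ t, n t (1 - u t) ≤ q (1 - u t) → ∀ i, n (t + 1) i ≤ q i := by
    intro t h i
    rcases key (u t) i with rfl | rfl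
    · exact (hleast t (feas t h)).2 (hanti _ _ _ _ h (hq _))
    · exact (hother t).trans_le h
  by_cases hT : ∃ T, ∀ i, n T i ≤ q i
  · obtain ⟨T, hT⟩ := hT
    have all : ∀ t, T ≤ t → ∀ i, n t i ≤ q i := by
      intro t ht
      induction t, ht using Nat.le_induction with
      | base => exact hT
      | succ t ht ih => exact le_q t (ih _)
    exact ⟨T, fun t ht => feas t (all t ht _)⟩
  · refine ⟨0, fun t _ => ?_⟩
    by_contra hF
    have notzero : ∀ t', n t' (1 - u t') ≠ 0 := fun t' h0 =>
      hT ⟨t' + 1, le_q t' (by omega)⟩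
    have stay : ∀ t', t + 1 ≤ t' → n t' (u t) = 0 ∧ ¬ F (u t) M (n t' (1 - u t)) := by
      intro t' ht'
      induction t', ht' using Nat.le_induction with
      | base => exact ⟨hzero t hF, by rwa [hother]⟩
      | succ t' ht' ih =>
        rcases key (u t) (u t') with h | h
        · rw [← h] at ih ⊢
          exact ⟨hzero t' ih.2, by rw [hother]; exact ih.2⟩
        · exact absurd (by rw [h, inv]; exact ih.1) (notzero t')
    obtain ⟨t', ht', h⟩ := hu (1 - u t) (t + 1)
    exact notzero t' (by rw [h, inv]; exact (stay t' ht').1)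

end Counts

/-! ### Slots ordered by interference -/

/-- A weight ordering the slots by the interference caused by activity in the slots of `B`, with
ties broken by slot index. -/
def slotWeight {M : ℕ} (B : Finset (Fin M)) (x : Fin M) : ℕ :=
  x.val + if x ∈ B then M else 0

/-- The slots of `A` have smaller weight, with respect to activity in `B`, than all the others. -/
def IsPacking {M : ℕ} (B A : Finset (Fin M)) : Prop :=
  ∀ x ∈ A, ∀ y ∉ A, slotWeight B x < slotWeight B y

section Packing

variable {M : ℕ} {A A' B : Finset (Fin M)}

theorem sum_slotWeight (A B : Finset (Fin M)) :
    ∑ x ∈ A, slotWeight B x = ∑ x ∈ A, x.val + M * #(A ∩ B) := by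
  simp only [slotWeight, sum_add_distrib, sum_ite_mem, sum_const, smul_eq_mul, mul_comm]

theorem IsPacking.sum_slotWeight_lt (h : IsPacking B A) (hcard : #A' = #A) (hne : A' ≠ A) :
    ∑ x ∈ A, slotWeight B x < ∑ x ∈ A', slotWeight B x := by
  have hc : #(A \ A') = #(A' \ A) := by
    have h₁ := card_sdiff_add_card_inter A A'
    have h₂ := card_sdiff_add_card_inter A' A
    rw [inter_comm] at h₂
    omega
  have hne' : (A \ A').Nonempty := by
    rw [sdiff_nonempty]
    exact fun hs => hne (eq_of_subset_of_card_le hs hcard.le).symm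
  obtain ⟨c, hcm, hmax⟩ := exists_max_image (A \ A') (slotWeight B) hne'
  have hlt : ∑ x ∈ A \ A', slotWeight B x < ∑ x ∈ A' \ A, slotWeight B x := by
    calc ∑ x ∈ A \ A', slotWeight B x ≤ #(A \ A') • slotWeight B c :=
          sum_le_card_nsmul _ _ _ hmax
      _ = ∑ _x ∈ A' \ A, slotWeight B c := by rw [hc, sum_const]
      _ < ∑ x ∈ A' \ A, slotWeight B x := by
          refine sum_lt_sum_of_nonempty (card_pos.1 (hc ▸ card_pos.2 hne')) fun y hy => ?_
          exact h c (mem_sdiff.1 hcm).1 y (mem_sdiff.1 hy).2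
  exact sum_sdiff_lt_sum_sdiff.1 hlt

theorem IsPacking.disjoint_or_union_eq (h : IsPacking B A) : A ∩ B = ∅ ∨ A ∪ B = univ := by
  by_contra! hne
  obtain ⟨x, hx⟩ := hne.1
  obtain ⟨y, hy⟩ : ∃ y, y ∉ A ∪ B := by
    by_contra! hall
    exact hne.2 (eq_univ_of_forall hall)
  rw [mem_inter] at hx
  rw [notMem_union] at hy
  have := h x hx.1 y hy.1
  simp only [slotWeight, hx.2, hy.2, if_true, if_false] at this
  have := y.isLt
  omega

theorem IsPacking.card_inter (h : IsPacking B A) : #(A ∩ B) = #A + #B - M := by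
  have hu := card_union_add_card_inter A B
  have hle := card_le_univ (A ∪ B)
  rw [Fintype.card_fin] at hle
  rcases h.disjoint_or_union_eq with h | h
  · rw [h, card_empty] at hu ⊢
    omega
  · rw [h, card_univ, Fintype.card_fin] at hu
    omega

theorem packing_eventually_const {S : ℕ → Fin 2 → Finset (Fin M)} {u : ℕ → Fin 2} (T : ℕ)
    (hother : ∀ t, S (t + 1) (1 - u t) = S t (1 - u t))
    (hcard : ∀ t, T ≤ t → ∀ i, #(S (t + 1) i) = #(S t i))
    (hpack : ∀ t, T ≤ t → IsPacking (S t (1 - u t)) (S (t + 1) (u t))) :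
    ∃ T', T ≤ T' ∧ ∀ t, T' ≤ t → S t = S T' := by
  have key : ∀ i j : Fin 2, j = i ∨ j = 1 - i := by decide
  let φ : ℕ → ℕ := fun t =>
    ∑ x ∈ S t 0, x.val + ∑ x ∈ S t 1, x.val + M * #(S t 0 ∩ S t 1)
  have φ_eq : ∀ t i, φ t =
      ∑ x ∈ S t i, slotWeight (S t (1 - i)) x + ∑ x ∈ S t (1 - i), x.val := by
    intro t i
    rw [sum_slotWeight]
    match i with
    | 0 => simp only [φ, sub_zero]; ring
    | 1 => simp only [φ, sub_self, inter_comm]; ring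
  have step : ∀ t, T ≤ t → S (t + 1) = S t ∨ φ (t + 1) < φ t := by
    intro t ht
    by_cases h : S t (u t) = S (t + 1) (u t)
    · left
      funext i
      rcases key (u t) i with rfl | rfl
      · exact h.symm
      · exact hother t
    · right
      rw [φ_eq t (u t), φ_eq (t + 1) (u t), hother]
      exact Nat.add_lt_add_right ((hpack t ht).sum_slotWeight_lt (hcard t ht _).symm h) _
  obtain ⟨T', hT', hc⟩ := eventually_const_of_antitone_from φ T fun t ht =>
    (step t ht).elim (fun h => by simp only [φ, h, le_refl]) le_of_lt
  refine ⟨T', hT', fun t ht => ?_⟩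
  induction t, ht using Nat.le_induction with
  | base => rfl
  | succ t ht ih =>
    rcases step t (by omega) with h | h
    · exact h.trans ih
    · rw [hc t ht, hc (t + 1) (by omega)] at h
      exact absurd h (lt_irrefl _)

end Packing

/-! ### Rates of on-off allocations -/

/-- The total rate over `k` well-chosen active slots out of `M`, when the other link has `b`
active slots, a slot being worth `hi` without interference and `lo` with interference. -/
noncomputable def packedRate (M : ℕ) (hi lo : ℝ) (k b : ℕ) : ℝ :=
  hi * k - (hi - lo) * ((k + b - M : ℕ) : ℝ)

section Rates

variable {M : ℕ} {hi lo : ℝ}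

theorem packedRate_mono (hlo : 0 ≤ lo) (hle : lo ≤ hi) {k k' : ℕ} (b : ℕ) (h : k ≤ k') :
    packedRate M hi lo k b ≤ packedRate M hi lo k' b := by
  unfold packedRate
  have h₁ : ((k' + b - M : ℕ) : ℝ) + k ≤ ((k + b - M : ℕ) : ℝ) + k' := by
    norm_cast
    omega
  have h₂ : (k : ℝ) ≤ k' := by exact_mod_cast h
  nlinarith

theorem packedRate_anti (hle : lo ≤ hi) (k : ℕ) {b b' : ℕ} (h : b' ≤ b) :
    packedRate M hi lo k b ≤ packedRate M hi lo k b' := by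
  unfold packedRate
  have h₁ : ((k + b' - M : ℕ) : ℝ) ≤ ((k + b - M : ℕ) : ℝ) := by
    norm_cast
    omega
  nlinarith

theorem sum_slotRate_eq (A B : Finset (Fin M)) :
    ∑ x ∈ A, (if x ∈ B then lo else hi) = hi * #A - (hi - lo) * #(A ∩ B) := by
  have h : ∀ x, (if x ∈ B then lo else hi) = hi - if x ∈ B then hi - lo else 0 := fun x => by
    split_ifs <;> ring
  simp only [h, sum_sub_distrib, sum_ite_mem, sum_const, nsmul_eq_mul]
  ring

theorem sum_slotRate_le (hle : lo ≤ hi) (A B : Finset (Fin M)) :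
    ∑ x ∈ A, (if x ∈ B then lo else hi) ≤ packedRate M hi lo #A #B := by
  rw [sum_slotRate_eq, packedRate]
  have hu := card_union_add_card_inter A B
  have hc := card_le_univ (A ∪ B)
  rw [Fintype.card_fin] at hc
  have h : ((#A + #B - M : ℕ) : ℝ) ≤ (#(A ∩ B) : ℝ) := by
    norm_cast
    omega
  nlinarith

theorem IsPacking.sum_slotRate {A B : Finset (Fin M)} (h : IsPacking B A) :
    ∑ x ∈ A, (if x ∈ B then lo else hi) = packedRate M hi lo #A #B := by
  rw [sum_slotRate_eq, packedRate, h.card_inter]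

theorem isPacking_univ (B : Finset (Fin M)) : IsPacking B univ :=
  fun _ _ y hy => absurd (mem_univ y) hy

end Rates

/-- The binary allocation with active slots `A`. -/
def onOff {M : ℕ} (Pmax : ℝ) (A : Finset (Fin M)) (m : Fin M) : ℝ :=
  if m ∈ A then Pmax else 0

theorem exists_eq_onOff {M : ℕ} {Pmax : ℝ} {q : Fin M → ℝ}
    (h : ∀ m, q m ∈ ({0, Pmax} : Set ℝ)) : ∃ A, q = onOff Pmax A := by
  classical
  refine ⟨univ.filter fun m => q m = Pmax, funext fun m => ?_⟩
  rcases h m with h | h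
  · by_cases h' : q m = Pmax <;> simp [onOff, h']
    exact h
  · have h' : q m = Pmax := h
    simp [onOff, h']

section Response

variable {M : ℕ} {f : ℝ → ℝ} {gii Pmax Rt : ℝ} {B : Finset (Fin M)} {I q : Fin M → ℝ}
  {Ilo Ihi : ℝ}

/-- The slots preceding position `k` in an enumeration sorted by weight form a packing. -/
theorem isPacking_map_filter {σ : Equiv.Perm (Fin M)} (hσ : StrictMono (slotWeight B ∘ σ))
    (k : ℕ) : IsPacking B ((univ.filter fun m : Fin M => m.val < k).map σ.toEmbedding) := by
  intro x hx y hy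
  simp only [mem_map_equiv, mem_filter, mem_univ, true_and] at hx hy
  have := @hσ (σ.symm x) (σ.symm y) (Fin.lt_def.2 (by omega))
  simpa using this

theorem card_map_filter_lt (σ : Equiv.Perm (Fin M)) {k : ℕ} (hk : k ≤ M) :
    #((univ.filter fun m : Fin M => m.val < k).map σ.toEmbedding) = k := by
  rw [card_map, Fin.card_filter_val_lt, min_eq_right hk]

theorem slotRate_eq (hI : ∀ m, I m = if m ∈ B then Ihi else Ilo) (m : Fin M) :
    f (gii * Pmax / I m) =
      if m ∈ B then f (gii * Pmax / Ihi) else f (gii * Pmax / Ilo) := by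
  rw [hI]
  split_ifs <;> rfl

theorem IsBPPResponse.exists_sorted (hI : ∀ m, I m = if m ∈ B then Ihi else Ilo)
    (hlt : Ilo < Ihi) (hq : IsBPPResponse f gii Pmax Rt I q)
    (hfeas : Rt ≤ 1 / (M : ℝ) *
      packedRate M (f (gii * Pmax / Ilo)) (f (gii * Pmax / Ihi)) M #B) :
    ∃ σ : Equiv.Perm (Fin M), StrictMono (slotWeight B ∘ σ) ∧ ∃ k ≤ M,
      IsLeast {k | Rt ≤ 1 / (M : ℝ) *
        packedRate M (f (gii * Pmax / Ilo)) (f (gii * Pmax / Ihi)) k #B} k ∧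
      q = onOff Pmax ((univ.filter fun m : Fin M => m.val < k).map σ.toEmbedding) := by
  have hrate := slotRate_eq (f := f) (gii := gii) (Pmax := Pmax) hI
  obtain ⟨σ, hσ, k, hk, hqσ⟩ := hq.2 (by
    simp only [hrate]
    rw [(isPacking_univ B).sum_slotRate, card_univ, Fintype.card_fin]
    exact hfeas)
  have hsorted : StrictMono (slotWeight B ∘ σ) := by
    intro l l' hll
    have h₀ := (σ l).isLt
    have h₁ := (σ l').isLt
    simp only [Function.comp_apply, slotWeight]
    rcases hσ l l' hll with h | ⟨h, h'⟩ <;> rw [hI, hI] at h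
    · by_cases hl : σ l ∈ B <;> by_cases hl' : σ l' ∈ B <;>
        simp only [hl, hl', if_true, if_false] at h ⊢
      · exact absurd h (lt_irrefl _)
      · exact absurd h hlt.not_gt
      · omega
      · exact absurd h (lt_irrefl _)
    · rw [Fin.lt_def] at h'
      by_cases hl : σ l ∈ B <;> by_cases hl' : σ l' ∈ B <;>
        simp only [hl, hl', if_true, if_false] at h ⊢
      · omega
      · exact absurd h hlt.ne'
      · omega
      · omega
  have hsum : ∀ k ≤ M, ∑ m ∈ univ.filter (fun m : Fin M => m.val < k), f (gii * Pmax / I (σ m)) =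
      packedRate M (f (gii * Pmax / Ilo)) (f (gii * Pmax / Ihi)) k #B := by
    intro k hkM
    have := (isPacking_map_filter hsorted k).sum_slotRate
      (hi := f (gii * Pmax / Ilo)) (lo := f (gii * Pmax / Ihi))
    rw [card_map_filter_lt σ hkM, sum_map] at this
    simpa only [hrate, Equiv.coe_toEmbedding] using this
  have hkM : k ≤ M := hk.2 (by rw [Set.mem_ofPred_eq, hsum M le_rfl]; exact hfeas)
  refine ⟨σ, hsorted, k, hkM, ⟨?_, fun k' hk' => ?_⟩, funext fun m => ?_⟩
  · have := hk.1
    rwa [Set.mem_ofPred_eq, hsum k hkM] at this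
  · rcases le_total k' M with h | h
    · exact hk.2 (by rw [Set.mem_ofPred_eq, hsum k' h]; exact hk')
    · exact hkM.trans h
  · have := hqσ (σ.symm m)
    simpa [onOff] using this

theorem IsBPPResponse.eq_zero (hI : ∀ m, I m = if m ∈ B then Ihi else Ilo)
    (hq : IsBPPResponse f gii Pmax Rt I q)
    (hfeas : ¬ Rt ≤ 1 / (M : ℝ) *
      packedRate M (f (gii * Pmax / Ilo)) (f (gii * Pmax / Ihi)) M #B) : q = 0 := by
  refine hq.1 ?_
  have hrate := slotRate_eq (f := f) (gii := gii) (Pmax := Pmax) hI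
  simp only [hrate]
  rw [(isPacking_univ B).sum_slotRate, card_univ, Fintype.card_fin]
  exact not_le.1 hfeas

theorem repulsive_of_sorted {σ : Equiv.Perm (Fin M)} (hσ : StrictMono (slotWeight B ∘ σ))
    {k : ℕ} (hk : k ≤ M) {p : Fin 2 → Fin M → ℝ}
    (h0 : p 0 = onOff Pmax ((univ.filter fun m : Fin M => m.val < k).map σ.toEmbedding))
    (h1 : p 1 = onOff Pmax B) : Repulsive Pmax p := by
  classical
  have hB : ∀ m m' : Fin M, m ≤ m' → σ m ∈ B → σ m' ∈ B := by
    intro m m' hm hmB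
    by_contra hmB'
    have := hσ.monotone hm
    simp only [Function.comp_apply, slotWeight, hmB, hmB', if_true, if_false] at this
    have := (σ m').isLt
    omega
  have hex : ∃ l : ℕ, ∀ m : Fin M, l ≤ m.val → σ m ∈ B := ⟨M, fun m hm => absurd m.isLt (by omega)⟩
  have hlM : Nat.find hex ≤ M := Nat.find_min' hex fun m hm => absurd m.isLt (by omega)
  refine ⟨σ, k, Nat.find hex + 1, by omega, by omega, fun m => ⟨fun h => ?_, fun h => ?_,
    fun h => ?_, fun h => ?_⟩⟩
  · have : m.val < k := by omega
    simp [h0, onOff, this]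
  · have : ¬ m.val < k := by omega
    simp [h0, onOff, this]
  · simp [h1, onOff, Nat.find_spec hex m (by omega)]
  · have : σ m ∉ B := fun hm => Nat.find_min hex (m := m.val) (by omega)
      fun m' hm' => hB m m' hm' hm
    simp [h1, onOff, this]

end Response

theorem univ_sdiff_singleton_fin_two (i : Fin 2) : (univ \ {i} : Finset (Fin 2)) = {1 - i} := by
  decide +revert

theorem frameRate_onOff {M : ℕ} {f : ℝ → ℝ} (hf0 : f 0 = 0) (g : Fin 2 → Fin 2 → ℝ)
    (N0 Pmax : ℝ) (S : Fin 2 → Finset (Fin M)) (i : Fin 2) :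
    frameRate f g N0 (fun j => onOff Pmax (S j)) i = 1 / (M : ℝ) * ∑ m ∈ S i,
      if m ∈ S (1 - i) then f (g i i * Pmax / (N0 + g (1 - i) i * Pmax))
      else f (g i i * Pmax / N0) := by
  rw [frameRate, univ_sdiff_singleton_fin_two, ← sum_filter_add_sum_filter_not univ (· ∈ S i)]
  rw [filter_mem_eq_inter, univ_inter, add_comm, sum_eq_zero, zero_add]
  · congr 1
    refine sum_congr rfl fun m hm => ?_
    by_cases h : m ∈ S (1 - i) <;> simp [onOff, hm, h]
  · intro m hm
    simp [onOff, (mem_filter.1 hm).2, hf0]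

/-- Theorem 1, binary version: for two links, Iterative Binary Power Packing,
started from any binary allocation and with an update sequence in which each
link is updated infinitely often, reaches in finite time a repulsive binary
allocation achieving any target rate vector in `R_M^IBPP`, and no longer moves
afterwards. -/
theorem iterative_binary_power_packing_converges
    (M : ℕ) (hM : 1 ≤ M) (f : ℝ → ℝ) (g : Fin 2 → Fin 2 → ℝ) (N0 Pmax : ℝ)
    (hg : ∀ i j, 0 < g i j) (hN0 : 0 < N0) (hP : 0 < Pmax)
    (hf_cont : ContinuousOn f (Set.Ici 0)) (hf_mono : MonotoneOn f (Set.Ici 0))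
    (hf_conc : ConcaveOn ℝ (Set.Ici 0) f) (hf0 : f 0 = 0)
    (hf_nonneg : ∀ x ∈ Set.Ici (0 : ℝ), 0 ≤ f x)
    (s : ℕ → Fin 2) (hs : ∀ i : Fin 2, ∀ t : ℕ, ∃ t', t ≤ t' ∧ s t' = i)
    (Rt : Fin 2 → ℝ)
    (p : ℕ → Fin 2 → Fin M → ℝ)
    (hbin0 : ∀ i m, p 0 i m ∈ ({0, Pmax} : Set ℝ))
    (hupd : ∀ t : ℕ, 1 ≤ t →
      (∀ j : Fin 2, j ≠ s t → p t j = p (t - 1) j) ∧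
      IsBPPResponse f (g (s t) (s t)) Pmax (Rt (s t))
        (fun m => N0 + ∑ j ∈ univ \ {s t}, g j (s t) * p (t - 1) j m)
        (p t (s t)))
    (hfeas : ∃ q : Fin 2 → Fin M → ℝ,
      (∀ i m, q i m ∈ ({0, Pmax} : Set ℝ)) ∧ Repulsive Pmax q ∧
      ∀ i, Rt i ≤ frameRate f g N0 q i) :
    ∃ T : ℕ, (∀ t, T ≤ t → p t = p T) ∧
      (∀ i m, p T i m ∈ ({0, Pmax} : Set ℝ)) ∧
      Repulsive Pmax (p T) ∧
      ∀ i, Rt i ≤ frameRate f g N0 (p T) i := by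
  have other_ne : ∀ i : Fin 2, 1 - i ≠ i := by decide
  set hi : Fin 2 → ℝ := fun i => f (g i i * Pmax / N0)
  set lo : Fin 2 → ℝ := fun i => f (g i i * Pmax / (N0 + g (1 - i) i * Pmax))
  have hpos : ∀ i j, 0 < g i j * Pmax := fun i j => mul_pos (hg i j) hP
  have harg : ∀ i, 0 ≤ g i i * Pmax / (N0 + g (1 - i) i * Pmax) := fun i =>
    div_nonneg (hpos _ _).le (add_pos hN0 (hpos _ _)).le
  have lo_nonneg : ∀ i, 0 ≤ lo i := fun i => hf_nonneg _ (harg i)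
  have lo_le : ∀ i, lo i ≤ hi i := fun i =>
    hf_mono (harg i) (div_nonneg (hpos _ _).le hN0.le)
      (div_le_div_of_nonneg_left (hpos _ _).le hN0 (by linarith [hpos (1 - i) i]))
  have hMinv : (0 : ℝ) ≤ 1 / (M : ℝ) := by positivity
  set F : Fin 2 → ℕ → ℕ → Prop := fun i k b =>
    Rt i ≤ 1 / (M : ℝ) * packedRate M (hi i) (lo i) k b
  have interference : ∀ t i (S : Finset (Fin M)), p t (1 - i) = onOff Pmax S → ∀ m,
      N0 + ∑ j ∈ univ \ {i}, g j i * p t j m =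
        if m ∈ S then N0 + g (1 - i) i * Pmax else N0 := by
    intro t i S hS m
    rw [univ_sdiff_singleton_fin_two, sum_singleton, hS, onOff]
    split_ifs <;> simp
  have hlt : ∀ i, N0 < N0 + g (1 - i) i * Pmax := fun i => by linarith [hpos (1 - i) i]
  have hSex : ∀ t, ∃ S : Fin 2 → Finset (Fin M), p t = fun i => onOff Pmax (S i) := by
    intro t
    induction t with
    | zero =>
      choose S hS using fun i => exists_eq_onOff (hbin0 i)
      exact ⟨S, funext hS⟩
    | succ t ih =>
      obtain ⟨S, hS⟩ := ih
      obtain ⟨hstay, hresp⟩ := hupd (t + 1) (by omega)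
      rw [Nat.add_sub_cancel] at hstay hresp
      have hI := interference t (s (t + 1)) _ (congrFun hS _)
      have hnew : ∃ A, p (t + 1) (s (t + 1)) = onOff Pmax A := by
        by_cases h : F (s (t + 1)) M #(S (1 - s (t + 1)))
        · obtain ⟨σ, -, k, -, -, hA⟩ := hresp.exists_sorted hI (hlt _) h
          exact ⟨_, hA⟩
        · exact ⟨∅, (hresp.eq_zero hI h).trans (funext fun m => by simp [onOff])⟩
      have hall : ∀ i, ∃ A, p (t + 1) i = onOff Pmax A := fun i => by
        by_cases h : i = s (t + 1)
        · exact h ▸ hnew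
        · exact ⟨S i, (hstay i h).trans (congrFun hS i)⟩
      choose A hA using hall
      exact ⟨A, funext hA⟩
  choose S hS using hSex
  have hinj : ∀ A B : Finset (Fin M), onOff Pmax A = onOff Pmax B → A = B := by
    intro A B h
    ext m
    have := congrFun h m
    by_cases hA : m ∈ A <;> by_cases hB : m ∈ B <;> simp_all [onOff, hP.ne, hP.ne']
  have hpS : ∀ t i, p t i = onOff Pmax (S t i) := fun t i => congrFun (hS t) i
  have hother : ∀ t, S (t + 1) (1 - s (t + 1)) = S t (1 - s (t + 1)) := fun t => hinj _ _ <| by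
    rw [← hpS, ← hpS]
    exact (hupd (t + 1) (by omega)).1 _ (other_ne _)
  have hsorted : ∀ t, F (s (t + 1)) M #(S t (1 - s (t + 1))) →
      ∃ σ : Equiv.Perm (Fin M), StrictMono (slotWeight (S t (1 - s (t + 1))) ∘ σ) ∧ ∃ k ≤ M,
        IsLeast {k | F (s (t + 1)) k #(S t (1 - s (t + 1)))} k ∧
        S (t + 1) (s (t + 1)) = (univ.filter fun m : Fin M => m.val < k).map σ.toEmbedding := by
    intro t h
    obtain ⟨-, hresp⟩ := hupd (t + 1) (by omega)
    rw [Nat.add_sub_cancel] at hresp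
    obtain ⟨σ, hσ, k, hkM, hk, hA⟩ :=
      hresp.exists_sorted (interference t (s (t + 1)) _ (hpS _ _)) (hlt _) h
    exact ⟨σ, hσ, k, hkM, hk, hinj _ _ ((hpS _ _).symm.trans hA)⟩
  have hzero : ∀ t, ¬ F (s (t + 1)) M #(S t (1 - s (t + 1))) →
      #(S (t + 1) (s (t + 1))) = 0 := by
    intro t h
    obtain ⟨-, hresp⟩ := hupd (t + 1) (by omega)
    rw [Nat.add_sub_cancel] at hresp
    have := hresp.eq_zero (interference t (s (t + 1)) _ (hpS _ _)) h
    rw [card_eq_zero]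
    refine hinj _ _ ((hpS _ _).symm.trans (this.trans (funext fun m => by simp [onOff])))
  have hs' : ∀ i t, ∃ t', t ≤ t' ∧ s (t' + 1) = i := by
    intro i t
    obtain ⟨t', ht', h⟩ := hs i (t + 1)
    exact ⟨t' - 1, by omega, by rwa [Nat.sub_add_cancel (by omega)]⟩
  obtain ⟨q, hqbin, -, hqrate⟩ := hfeas
  obtain ⟨Q, hQ⟩ : ∃ Q : Fin 2 → Finset (Fin M), q = fun i => onOff Pmax (Q i) := by
    choose Q hQ using fun i => exists_eq_onOff (hqbin i)
    exact ⟨Q, funext hQ⟩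
  have hcard_le : ∀ A : Finset (Fin M), #A ≤ M := fun A => by
    simpa using card_le_univ A
  obtain ⟨T, hT⟩ := counts_eventually_const (F := F) (M := M) (u := fun t => s (t + 1))
    (n := fun t i => #(S t i))
    (fun i k k' b h hk => hk.trans
      (mul_le_mul_of_nonneg_left (packedRate_mono (lo_nonneg i) (lo_le i) b h) hMinv))
    (fun i k b b' h hk => hk.trans
      (mul_le_mul_of_nonneg_left (packedRate_anti (lo_le i) k h) hMinv))
    hs' (fun t i => hcard_le _) (fun t => congrArg card (hother t))
    (fun t h => by
      obtain ⟨σ, -, k, hkM, hk, hA⟩ := hsorted t h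
      simp only [hA, card_map_filter_lt σ hkM]
      exact hk)
    hzero (fun i => #(Q i)) (fun i => hcard_le _)
    (fun i => by
      have := hqrate i
      rw [hQ, frameRate_onOff hf0] at this
      exact this.trans (mul_le_mul_of_nonneg_left (sum_slotRate_le (lo_le i) _ _) hMinv))
  obtain ⟨T', hTT', hconst⟩ := packing_eventually_const (S := S) (u := fun t => s (t + 1)) T hother
    (fun t ht i => ((hT (t + 1) (by omega)).2 i).trans ((hT t ht).2 i).symm)
    (fun t ht => by
      obtain ⟨σ, hσ, k, hkM, hk, hA⟩ := hsorted t (hT t ht).1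
      simp only [hA]
      exact isPacking_map_filter hσ k)
  have final : ∀ i, ∃ σ : Equiv.Perm (Fin M), StrictMono (slotWeight (S T' (1 - i)) ∘ σ) ∧
      ∃ k ≤ M, IsLeast {k | F i k #(S T' (1 - i))} k ∧
        S T' i = (univ.filter fun m : Fin M => m.val < k).map σ.toEmbedding := by
    intro i
    obtain ⟨t, ht, rfl⟩ := hs' i T'
    have := hsorted t (hT t (by omega)).1
    rwa [hconst t ht, hconst (t + 1) (by omega)] at this
  refine ⟨T', fun t ht => by rw [hS, hS, hconst t ht], fun i m => ?_, ?_, fun i => ?_⟩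
  · rw [hpS, onOff]
    split_ifs <;> simp
  · obtain ⟨σ, hσ, k, hkM, -, hA⟩ := final 0
    exact repulsive_of_sorted hσ hkM (hA ▸ hpS T' 0) (hpS T' 1)
  · obtain ⟨σ, hσ, k, hkM, hk, hA⟩ := final i
    rw [hS, frameRate_onOff hf0]
    have hpack := isPacking_map_filter hσ k
    rw [← hA] at hpack
    rw [hpack.sum_slotRate, hA, card_map_filter_lt σ hkM]
    exact hk.1
end

section
/- (Uniform frame size for ε-rate-optimality, content of Corollary 1.) For every ε > 0 there exists a frame size M(ε) such that for all M ≥ M(ε): every rate vector R ∈ ℝ_+^N with R + ε·(1,…,1) ∈ conv(S_1) satisfies R ∈ \bar S_M; that is, there exists a binary M-slot allocation p with R_i(p) ≥ R_i for every link i. -/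
open Finset

/-- Single-slot rate on link `i`. -/
noncomputable def singleRate {N : ℕ} (f : ℝ → ℝ) (g : Fin N → Fin N → ℝ) (N0 : ℝ)
    (p : Fin N → ℝ) (i : Fin N) : ℝ :=
  f (g i i * p i / (N0 + ∑ j ∈ univ \ {i}, g j i * p j))

/-- A point of the convex hull of a finite family is a convex combination of the whole family. -/
theorem exists_weights_of_mem_convexHull_range {ι E : Type*} [Fintype ι] [AddCommGroup E]
    [Module ℝ E] {v : ι → E} {x : E} (hx : x ∈ convexHull ℝ (Set.range v)) :
    ∃ w : ι → ℝ, (∀ s, 0 ≤ w s) ∧ ∑ s, w s = 1 ∧ ∑ s, w s • v s = x := by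
  classical
  rw [convexHull_range_eq_exists_affineCombination] at hx
  obtain ⟨t, w, hw0, hw1, rfl⟩ := hx
  refine ⟨fun s => if s ∈ t then w s else 0, fun s => ?_, ?_, ?_⟩
  · dsimp only
    split_ifs with h
    exacts [hw0 s h, le_rfl]
  · simpa [Finset.sum_ite_mem] using hw1
  · rw [Finset.affineCombination_eq_linear_combination _ _ _ hw1]
    simp [ite_smul, Finset.sum_ite_mem]

/-- Time-sharing weights can be realised by `M` slots up to an additive error not depending on
`M`. -/
theorem exists_slot_assignment {ι : Type*} [Fintype ι] [Nonempty ι] {w : ι → ℝ}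
    (hw0 : ∀ s, 0 ≤ w s) (hw1 : ∑ s, w s = 1) (M : ℕ) :
    ∃ c : Fin M → ι, ∀ v : ι → ℝ, (∀ s, 0 ≤ v s) →
      M * ∑ s, w s * v s - ∑ s, v s ≤ ∑ m, v (c m) := by
  have hcard : Fintype.card (Σ s, Fin ⌊M * w s⌋₊) ≤ Fintype.card (Fin M) := by
    simp only [Fintype.card_sigma, Fintype.card_fin]
    have h : ((∑ s, ⌊M * w s⌋₊ : ℕ) : ℝ) ≤ M := by
      push_cast
      calc ∑ s, (⌊M * w s⌋₊ : ℝ) ≤ ∑ s, M * w s :=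
            Finset.sum_le_sum fun s _ => Nat.floor_le (mul_nonneg M.cast_nonneg (hw0 s))
        _ = M := by rw [← Finset.mul_sum, hw1, mul_one]
    exact_mod_cast h
  obtain ⟨e⟩ := Function.Embedding.nonempty_of_card_le hcard
  refine ⟨Function.extend e Sigma.fst fun _ => Classical.arbitrary ι, fun v hv => ?_⟩
  calc M * ∑ s, w s * v s - ∑ s, v s = ∑ s, (M * w s - 1) * v s := by
        rw [Finset.mul_sum, ← Finset.sum_sub_distrib]
        exact Finset.sum_congr rfl fun s _ => by ring
    _ ≤ ∑ s, (⌊M * w s⌋₊ : ℝ) * v s :=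
        Finset.sum_le_sum fun s _ =>
          mul_le_mul_of_nonneg_right (Nat.sub_one_lt_floor _).le (hv s)
    _ = ∑ x : (Σ s, Fin ⌊M * w s⌋₊), v x.1 := by simp [Fintype.sum_sigma]
    _ = ∑ m ∈ Finset.univ.map e,
          v (Function.extend e Sigma.fst (fun _ => Classical.arbitrary ι) m) := by
        simp [e.injective.extend_apply]
    _ ≤ _ := Finset.sum_le_sum_of_subset_of_nonneg (Finset.subset_univ _) fun m _ _ => hv _

/-- Power vector in which exactly the links of `s` transmit, at power `P`. -/
noncomputable def onOffPower {N : ℕ} (P : ℝ) (s : Finset (Fin N)) (i : Fin N) : ℝ :=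
  if i ∈ s then P else 0

theorem onOffPower_mem {N : ℕ} (P : ℝ) (s : Finset (Fin N)) (i : Fin N) :
    onOffPower P s i ∈ ({0, P} : Set ℝ) := by
  unfold onOffPower
  split_ifs <;> simp

theorem exists_eq_onOffPower {N : ℕ} {P : ℝ} {q : Fin N → ℝ}
    (hq : ∀ i, q i ∈ ({0, P} : Set ℝ)) : ∃ s, q = onOffPower P s := by
  classical
  refine ⟨univ.filter fun i => q i = P, funext fun i => ?_⟩
  rcases hq i with h | h
  · by_cases h' : q i = P
    · simp [onOffPower, h']
    · simpa [onOffPower, h'] using h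
  · simp [onOffPower, Set.mem_singleton_iff.1 h]

theorem singleRate_nonneg {N : ℕ} {f : ℝ → ℝ} {g : Fin N → Fin N → ℝ} {N0 : ℝ} {p : Fin N → ℝ}
    (hg : ∀ i j, 0 ≤ g i j) (hN0 : 0 ≤ N0) (hf : ∀ x ∈ Set.Ici (0 : ℝ), 0 ≤ f x)
    (hp : ∀ i, 0 ≤ p i) (i : Fin N) : 0 ≤ singleRate f g N0 p i :=
  hf _ <| div_nonneg (mul_nonneg (hg i i) (hp i)) <|
    add_nonneg hN0 <| Finset.sum_nonneg fun j _ => mul_nonneg (hg j i) (hp j)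

/-- Uniform frame size for ε-rate-optimality (content of Corollary 1): for
every `ε > 0` there is a frame size `M(ε)` such that for every `M ≥ M(ε)`,
every nonnegative rate vector `R` with `R + ε·1 ∈ conv(S_1)` is dominated by
the rate vector of some binary `M`-slot allocation. -/
theorem uniform_frame_size_for_eps_rate_optimality
    {N : ℕ} (f : ℝ → ℝ) (g : Fin N → Fin N → ℝ) (N0 Pmax : ℝ)
    (hg : ∀ i j, 0 < g i j) (hN0 : 0 < N0) (hP : 0 < Pmax)
    (hf_cont : ContinuousOn f (Set.Ici 0)) (hf_mono : MonotoneOn f (Set.Ici 0))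
    (hf_conc : ConcaveOn ℝ (Set.Ici 0) f) (hf0 : f 0 = 0)
    (hf_nonneg : ∀ x ∈ Set.Ici (0 : ℝ), 0 ≤ f x)
    (ε : ℝ) (hε : 0 < ε) :
    ∃ M₀ : ℕ, 1 ≤ M₀ ∧ ∀ M : ℕ, M₀ ≤ M →
      ∀ R : Fin N → ℝ, (∀ i, 0 ≤ R i) →
        (fun i => R i + ε) ∈ convexHull ℝ {r : Fin N → ℝ | ∃ q : Fin N → ℝ,
          (∀ i, q i ∈ ({0, Pmax} : Set ℝ)) ∧ r = singleRate f g N0 q} →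
        ∃ p : Fin N → Fin M → ℝ,
          (∀ i m, p i m ∈ ({0, Pmax} : Set ℝ)) ∧
          ∀ i, R i ≤ frameRate f g N0 p i := by
  have hset : {r : Fin N → ℝ | ∃ q : Fin N → ℝ,
      (∀ i, q i ∈ ({0, Pmax} : Set ℝ)) ∧ r = singleRate f g N0 q} =
      Set.range fun s => singleRate f g N0 (onOffPower Pmax s) := by
    ext r
    constructor
    · rintro ⟨q, hq, rfl⟩
      obtain ⟨s, rfl⟩ := exists_eq_onOffPower hq
      exact ⟨s, rfl⟩
    · rintro ⟨s, rfl⟩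
      exact ⟨_, onOffPower_mem Pmax s, rfl⟩
  have hrate : ∀ s i, 0 ≤ singleRate f g N0 (onOffPower Pmax s) i := fun s =>
    singleRate_nonneg (fun i j => (hg i j).le) hN0.le hf_nonneg fun i => by
      unfold onOffPower
      split_ifs
      exacts [hP.le, le_rfl]
  set B : ℝ := ∑ i, ∑ s, singleRate f g N0 (onOffPower Pmax s) i
  refine ⟨⌈B / ε⌉₊ + 1, by omega, fun M hM R _ hR => ?_⟩
  rw [hset] at hR
  obtain ⟨w, hw0, hw1, hw⟩ := exists_weights_of_mem_convexHull_range hR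
  obtain ⟨c, hc⟩ := exists_slot_assignment hw0 hw1 M
  refine ⟨fun i m => onOffPower Pmax (c m) i, fun i m => onOffPower_mem _ _ _, fun i => ?_⟩
  have hMpos : (0 : ℝ) < M := by exact_mod_cast (by omega : 0 < M)
  have hBM : B ≤ M * ε := by
    rw [← div_le_iff₀ hε]
    exact (Nat.le_ceil _).trans (by exact_mod_cast (by omega : ⌈B / ε⌉₊ ≤ M))
  have hBi : ∑ s, singleRate f g N0 (onOffPower Pmax s) i ≤ B :=
    Finset.single_le_sum (f := fun i => ∑ s, singleRate f g N0 (onOffPower Pmax s) i)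
      (fun j _ => Finset.sum_nonneg fun s _ => hrate s j) (Finset.mem_univ i)
  have hwi : ∑ s, w s * singleRate f g N0 (onOffPower Pmax s) i = R i + ε := by
    simpa [Finset.sum_apply] using congrFun hw i
  have hci := hc (fun s => singleRate f g N0 (onOffPower Pmax s) i) fun s => hrate s i
  have hframe : frameRate f g N0 (fun i m => onOffPower Pmax (c m) i) i =
      (∑ m, singleRate f g N0 (onOffPower Pmax (c m)) i) / M := by
    rw [div_eq_inv_mul, ← one_div]
    rfl
  rw [hframe, le_div_iff₀ hMpos]
  rw [hwi] at hci
  nlinarith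
end
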